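/- arXiv:1510.01948 — 4 statements merged into one kernel-verified Lean document; each statement's English description precedes it below -/
import Mathlib

section
/- Let Σ_X and Σ_Y be symmetric positive definite d×d real matrices, and let F := Σ_Y^{1/2} (Σ_Y^{1/2} Σ_X Σ_Y^{1/2})^{-1/2} Σ_Y^{1/2}, where M^{1/2} denotes the unique symmetric positive definite square root of a symmetric positive definite matrix M. Then F is symmetric positive definite and satisfies F Σ_X Fᵀ = Σ_Y. -/
open Matrix

/-- The transport matrix `F = Σ_Y^{1/2} (Σ_Y^{1/2} Σ_X Σ_Y^{1/2})^{-1/2} Σ_Y^{1/2}`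
(with square roots given as the unique symmetric positive definite square roots)
is symmetric positive definite and satisfies `F Σ_X Fᵀ = Σ_Y`. -/
theorem optimal_transport_matrix_posDef_and_pushforward
    {d : ℕ} (CovX CovY SY Mh F : Matrix (Fin d) (Fin d) ℝ)
    (hX : CovX.PosDef) (hY : CovY.PosDef)
    -- `SY` is the unique symmetric positive definite square root of `CovY`
    (hSY : SY.PosDef) (hSY2 : SY * SY = CovY)
    -- `Mh` is the unique symmetric positive definite square root of `SY * CovX * SY`
    (hMh : Mh.PosDef) (hMh2 : Mh * Mh = SY * CovX * SY)
    (hF : F = SY * Mh⁻¹ * SY) :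
    F.PosDef ∧ F * CovX * Fᵀ = CovY := by
  have hFp : F.PosDef := by
    have h := hMh.inv.conjTranspose_mul_mul_same (B := SY)
      (Matrix.mulVec_injective_of_isUnit hSY.isUnit)
    rw [hSY.isHermitian.eq] at h
    rw [hF]
    exact h
  refine ⟨hFp, ?_⟩
  have hFt : Fᵀ = F := by
    have h := hFp.isHermitian.eq
    rwa [Matrix.conjTranspose_eq_transpose_of_trivial] at h
  have hdet : IsUnit Mh.det := (Matrix.isUnit_iff_isUnit_det _).1 hMh.isUnit
  rw [hFt, hF]
  calc SY * Mh⁻¹ * SY * CovX * (SY * Mh⁻¹ * SY)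
      = SY * Mh⁻¹ * (SY * CovX * SY) * Mh⁻¹ * SY := by simp only [Matrix.mul_assoc]
    _ = SY * (Mh⁻¹ * Mh) * (Mh * Mh⁻¹) * SY := by
        rw [← hMh2]; simp only [Matrix.mul_assoc]
    _ = CovY := by
        rw [Matrix.nonsing_inv_mul _ hdet, Matrix.mul_nonsing_inv _ hdet, Matrix.mul_one,
          Matrix.mul_one, hSY2]
end

section
/- Let Σ_X and Σ_Y be symmetric positive definite d×d real matrices, and let F := Σ_Y^{1/2} (Σ_Y^{1/2} Σ_X Σ_Y^{1/2})^{-1/2} Σ_Y^{1/2}. Then trace(F Σ_X) = trace(F⁻¹ Σ_Y) = trace((Σ_Y^{1/2} Σ_X Σ_Y^{1/2})^{1/2}). -/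
open Matrix

/-- For the transport matrix `F = Σ_Y^{1/2} (Σ_Y^{1/2} Σ_X Σ_Y^{1/2})^{-1/2} Σ_Y^{1/2}`,
one has `trace(F Σ_X) = trace(F⁻¹ Σ_Y) = trace((Σ_Y^{1/2} Σ_X Σ_Y^{1/2})^{1/2})`. -/
theorem optimal_transport_matrix_trace_identities
    {d : ℕ} (CovX CovY SY Mh F : Matrix (Fin d) (Fin d) ℝ)
    (hX : CovX.PosDef) (hY : CovY.PosDef)
    -- `SY` is the unique symmetric positive definite square root of `CovY`
    (hSY : SY.PosDef) (hSY2 : SY * SY = CovY)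
    -- `Mh` is the unique symmetric positive definite square root of `SY * CovX * SY`
    (hMh : Mh.PosDef) (hMh2 : Mh * Mh = SY * CovX * SY)
    (hF : F = SY * Mh⁻¹ * SY) :
    (F * CovX).trace = (F⁻¹ * CovY).trace ∧ (F⁻¹ * CovY).trace = Mh.trace := by
  have hS : IsUnit SY.det := (Matrix.isUnit_iff_isUnit_det _).1 hSY.isUnit
  have hM : IsUnit Mh.det := (Matrix.isUnit_iff_isUnit_det _).1 hMh.isUnit
  have h1 : (F⁻¹ * CovY).trace = Mh.trace := by
    have e : F⁻¹ * CovY = SY⁻¹ * (Mh * SY) := by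
      rw [hF, ← hSY2, Matrix.mul_inv_rev, Matrix.mul_inv_rev,
        Matrix.nonsing_inv_nonsing_inv _ hM]
      simp only [Matrix.mul_assoc]
      rw [Matrix.nonsing_inv_mul_cancel_left _ _ hS]
    rw [e, Matrix.trace_mul_comm, Matrix.mul_assoc, Matrix.mul_nonsing_inv _ hS, Matrix.mul_one]
  have h2 : (F * CovX).trace = Mh.trace := by
    have e : F * CovX = SY * (Mh⁻¹ * (SY * CovX)) := by
      rw [hF]; simp only [Matrix.mul_assoc]
    rw [e, Matrix.trace_mul_comm, Matrix.mul_assoc, ← hMh2,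
      Matrix.nonsing_inv_mul_cancel_left _ _ hM]
  exact ⟨h2.trans h1.symm, h1⟩
end

section
/- Let X̂, Ŷ ∈ ℝ and v_X, v_Y > 0, and let μ be the Gaussian measure on ℝ with mean X̂ and variance v_X. For every measurable map T : ℝ → ℝ whose pushforward of μ equals the Gaussian measure with mean Ŷ and variance v_Y, one has ∫ (T(x) − x)² dμ(x) ≥ (Ŷ − X̂)² + (√v_Y − √v_X)². -/
open MeasureTheory ProbabilityTheory

/-- Optimality of the scalar Gaussian transport map: every measurable map `T` that
pushes `N(X̂, v_X)` forward to `N(Ŷ, v_Y)` has transportation cost at least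
`(Ŷ − X̂)² + (√v_Y − √v_X)²`. -/
theorem scalar_transport_cost_lower_bound
    (Xhat Yhat : ℝ) (vX vY : NNReal) (hvX : 0 < vX) (hvY : 0 < vY)
    (T : ℝ → ℝ) (hT : Measurable T)
    (hpush : Measure.map T (gaussianReal Xhat vX) = gaussianReal Yhat vY) :
    (Yhat - Xhat) ^ 2 + (Real.sqrt (vY : ℝ) - Real.sqrt (vX : ℝ)) ^ 2 ≤
      ∫ x, (T x - x) ^ 2 ∂(gaussianReal Xhat vX) := by
  set μ := gaussianReal Xhat vX with hμ
  have hXm : MemLp (fun x : ℝ => x) 2 μ := memLp_id_gaussianReal' 2 (by simp)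
  have hYm : MemLp (fun x : ℝ => x) 2 (gaussianReal Yhat vY) :=
    memLp_id_gaussianReal' 2 (by simp)
  have hTm : MemLp T 2 μ := by
    rw [← hpush] at hYm
    exact hYm.comp_of_map hT.aemeasurable
  have hTI : ∫ x, T x ∂μ = Yhat := by
    have h := integral_map (μ := μ) hT.aemeasurable (f := fun x : ℝ => x)
      measurable_id.aestronglyMeasurable
    rw [hpush, integral_id_gaussianReal] at h
    exact h.symm
  have hXI : ∫ x, x ∂μ = Xhat := integral_id_gaussianReal
  have hXV : ∫ x, (x - Xhat) ^ 2 ∂μ = vX := by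
    have h := variance_fun_id_gaussianReal (μ := Xhat) (v := vX)
    rw [variance_eq_integral (by fun_prop), integral_id_gaussianReal] at h
    exact h
  have hTV : ∫ x, (T x - Yhat) ^ 2 ∂μ = vY := by
    have h := variance_fun_id_gaussianReal (μ := Yhat) (v := vY)
    rw [variance_eq_integral (by fun_prop), integral_id_gaussianReal, ← hpush,
      integral_map hT.aemeasurable (by fun_prop)] at h
    exact h
  have hA : MemLp (fun x => T x - Yhat) 2 μ := hTm.sub (memLp_const Yhat)
  have hB : MemLp (fun x => x - Xhat) 2 μ := hXm.sub (memLp_const Xhat)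
  have hC : MemLp (fun x => T x - x) 2 μ := hTm.sub hXm
  have ha : 0 < Real.sqrt (vX : ℝ) := Real.sqrt_pos.2 hvX
  have hb : 0 < Real.sqrt (vY : ℝ) := Real.sqrt_pos.2 hvY
  have ha2 : Real.sqrt (vX : ℝ) ^ 2 = vX := Real.sq_sqrt vX.2
  have hb2 : Real.sqrt (vY : ℝ) ^ 2 = vY := Real.sq_sqrt vY.2
  set a := Real.sqrt (vX : ℝ)
  set b := Real.sqrt (vY : ℝ)
  have i1 : Integrable (fun x => (1 - a / b) * (T x - Yhat) ^ 2) μ := hA.integrable_sq.const_mul _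
  have i2 : Integrable (fun x => (1 - b / a) * (x - Xhat) ^ 2) μ := hB.integrable_sq.const_mul _
  have iT : Integrable T μ := hTm.integrable (by norm_num)
  have iX : Integrable (fun x : ℝ => x) μ := hXm.integrable (by norm_num)
  have iC : Integrable (fun x => T x - x) μ := iT.sub iX
  have i3 : Integrable (fun x => 2 * (Yhat - Xhat) * (T x - x)) μ := iC.const_mul _
  have i4 : Integrable (fun _ : ℝ => (Yhat - Xhat) ^ 2) μ := integrable_const _
  have i12 : Integrable (fun x => (1 - a / b) * (T x - Yhat) ^ 2
      + (1 - b / a) * (x - Xhat) ^ 2) μ := i1.add i2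
  have i123 : Integrable (fun x => (1 - a / b) * (T x - Yhat) ^ 2
      + (1 - b / a) * (x - Xhat) ^ 2 + 2 * (Yhat - Xhat) * (T x - x)) μ := i12.add i3
  have key : ∫ x, ((1 - a / b) * (T x - Yhat) ^ 2 + (1 - b / a) * (x - Xhat) ^ 2
      + 2 * (Yhat - Xhat) * (T x - x) - (Yhat - Xhat) ^ 2) ∂μ
      = (Yhat - Xhat) ^ 2 + (b - a) ^ 2 := by
    rw [integral_sub i123 i4, integral_add i12 i3, integral_add i1 i2,
      integral_const_mul, integral_const_mul, integral_const_mul, integral_sub iT iX,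
      hTI, hXI, hXV, hTV, ← ha2, ← hb2]
    simp
    field_simp
    ring
  rw [← key]
  refine integral_mono (i123.sub i4) hC.integrable_sq fun x => ?_
  have h : 0 ≤ (b * (x - Xhat) - a * (T x - Yhat)) ^ 2 / (a * b) := by positivity
  have e : (T x - x) ^ 2 - ((1 - a / b) * (T x - Yhat) ^ 2 + (1 - b / a) * (x - Xhat) ^ 2
      + 2 * (Yhat - Xhat) * (T x - x) - (Yhat - Xhat) ^ 2)
      = (b * (x - Xhat) - a * (T x - Yhat)) ^ 2 / (a * b) := by
    field_simp
    ring
  show _ ≤ (T x - x) ^ 2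
  linarith
end

section
/- Let Σ be a symmetric positive definite d×d real matrix, and let A, C be real matrices of sizes d×d and m×d respectively. A d×d real matrix G satisfies G Σ + Σ Gᵀ = A Σ + Σ Aᵀ + I − Σ CᵀC Σ if and only if there exists a skew-symmetric d×d matrix Ω such that G = A + (1/2)Σ⁻¹ − (1/2)Σ CᵀC + Ω Σ⁻¹. -/
open Matrix

/-- Non-uniqueness of the FPF control law: `G` solves
`G Σ + Σ Gᵀ = A Σ + Σ Aᵀ + I − Σ CᵀC Σ` if and only if
`G = A + (1/2)Σ⁻¹ − (1/2)Σ CᵀC + Ω Σ⁻¹` for some skew-symmetric matrix `Ω`. -/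
theorem fpf_gain_characterization
    {d m : ℕ} (Sig : Matrix (Fin d) (Fin d) ℝ) (hSig : Sig.PosDef)
    (A : Matrix (Fin d) (Fin d) ℝ) (C : Matrix (Fin m) (Fin d) ℝ)
    (G : Matrix (Fin d) (Fin d) ℝ) :
    G * Sig + Sig * Gᵀ = A * Sig + Sig * Aᵀ + 1 - Sig * (Cᵀ * C) * Sig ↔
      ∃ Om : Matrix (Fin d) (Fin d) ℝ, Omᵀ = -Om ∧
        G = A + (1 / 2 : ℝ) • Sig⁻¹ - (1 / 2 : ℝ) • (Sig * (Cᵀ * C)) + Om * Sig⁻¹ := by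
  have hT : Sigᵀ = Sig := by
    have h := hSig.isHermitian.eq
    rwa [Matrix.conjTranspose_eq_transpose_of_trivial] at h
  have hu : IsUnit Sig.det := hSig.det_pos.ne'.isUnit
  have h1 : Sig * Sig⁻¹ = 1 := Matrix.mul_nonsing_inv _ hu
  have h2 : Sig⁻¹ * Sig = 1 := Matrix.nonsing_inv_mul _ hu
  have hP : (Sig * (Cᵀ * C) * Sig)ᵀ = Sig * (Cᵀ * C) * Sig := by
    simp [Matrix.transpose_mul, hT, Matrix.mul_assoc]
  have hG : Sig * Gᵀ = (G * Sig)ᵀ := by rw [Matrix.transpose_mul, hT]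
  have hA : Sig * Aᵀ = (A * Sig)ᵀ := by rw [Matrix.transpose_mul, hT]
  rw [hG, hA]
  constructor
  · intro h
    refine ⟨G * Sig - A * Sig - (1 / 2 : ℝ) • 1
      + (1 / 2 : ℝ) • (Sig * (Cᵀ * C) * Sig), ?_, ?_⟩
    · have h' := eq_sub_of_add_eq' h
      simp only [Matrix.transpose_add, Matrix.transpose_sub, Matrix.transpose_smul, hP,
        Matrix.transpose_one]
      rw [h']
      module
    · simp only [Matrix.add_mul, Matrix.sub_mul, Matrix.smul_mul, Matrix.one_mul,
        Matrix.mul_assoc _ Sig Sig⁻¹, h1, Matrix.mul_one]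
      module
  · rintro ⟨Om, hO, hg⟩
    have e : G * Sig = A * Sig + (1 / 2 : ℝ) • 1
        - (1 / 2 : ℝ) • (Sig * (Cᵀ * C) * Sig) + Om := by
      rw [hg]
      simp only [Matrix.add_mul, Matrix.sub_mul, Matrix.smul_mul,
        Matrix.mul_assoc _ Sig⁻¹ Sig, h2, Matrix.mul_one]
    rw [e]
    simp only [Matrix.transpose_add, Matrix.transpose_sub, Matrix.transpose_smul, hP,
      Matrix.transpose_one, hO]
    module
end
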